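/- Let R be a left GF-closed ring with l.Gwdim(R) < ∞ and let n be a positive integer. Then l.Gwdim(R) ≤ n if and only if Gfd_R(M) ≤ n for every finitely presented left R-module M. -/

import Mathlib

/-!
Background definitions for D. Bennis, "Weak Gorenstein global dimensions".

Conventions.  All rings are associative with identity.  A *left* `R`-module is a type with
`[AddCommGroup M] [Module R M]`; a *right* `R`-module is a left module over the opposite ring,
i.e. `[Module Rᵐᵒᵖ M]`.  All "right-handed" notions below are obtained by applying the
corresponding "left-handed" notion to the opposite ring `Rᵐᵒᵖ`.
-/

open MulOpposite

universe u

section Tensor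

variable (S : Type u) [Ring S]

/-- The subgroup of relations defining the tensor product `A ⊗_S M` of a right `S`-module `A`
and a left `S`-module `M` over a (possibly noncommutative) ring `S`. -/
def tensorRels (A : Type u) [AddCommGroup A] [Module Sᵐᵒᵖ A]
    (M : Type u) [AddCommGroup M] [Module S M] :
    AddSubgroup (FreeAbelianGroup (A × M)) :=
  AddSubgroup.closure
    { x | (∃ a₁ a₂ m, x = FreeAbelianGroup.of (a₁ + a₂, m) - FreeAbelianGroup.of (a₁, m) -
            FreeAbelianGroup.of (a₂, m)) ∨
          (∃ a m₁ m₂, x = FreeAbelianGroup.of (a, m₁ + m₂) - FreeAbelianGroup.of (a, m₁) -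
            FreeAbelianGroup.of (a, m₂)) ∨
          (∃ (a : A) (r : S) (m : M), x = FreeAbelianGroup.of (op r • a, m) - FreeAbelianGroup.of (a, r • m)) }

/-- The tensor product `A ⊗_S M` (an abelian group) of a right `S`-module `A` and a left
`S`-module `M` over a (possibly noncommutative) ring `S`. -/
def NTensor (A : Type u) [AddCommGroup A] [Module Sᵐᵒᵖ A]
    (M : Type u) [AddCommGroup M] [Module S M] : Type u :=
  FreeAbelianGroup (A × M) ⧸ tensorRels S A M

instance (A : Type u) [AddCommGroup A] [Module Sᵐᵒᵖ A]
    (M : Type u) [AddCommGroup M] [Module S M] : AddCommGroup (NTensor S A M) :=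
  QuotientAddGroup.Quotient.addCommGroup _

namespace NTensor

variable {S}
variable {A A' : Type u} [AddCommGroup A] [Module Sᵐᵒᵖ A] [AddCommGroup A'] [Module Sᵐᵒᵖ A']
variable {M M' : Type u} [AddCommGroup M] [Module S M] [AddCommGroup M'] [Module S M']

/-- Functoriality of `A ⊗_S −` : the map `A ⊗_S M → A ⊗_S M'` induced by a linear map
`g : M → M'` of left `S`-modules. -/
def rmap (A : Type u) [AddCommGroup A] [Module Sᵐᵒᵖ A] (g : M →ₗ[S] M') :
    NTensor S A M →+ NTensor S A M' :=
  QuotientAddGroup.map (tensorRels S A M) (tensorRels S A M') (FreeAbelianGroup.map (Prod.map id g)) (by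
    simp only [tensorRels]
    refine (AddSubgroup.closure_le _).2 ?_
    rintro x (⟨a₁, a₂, m, rfl⟩ | ⟨a, m₁, m₂, rfl⟩ | ⟨a, r, m, rfl⟩) <;>
      refine SetLike.mem_coe.2 (AddSubgroup.mem_comap.2 (AddSubgroup.subset_closure ?_)) <;>
      simp only [map_sub, map_add, map_smul, FreeAbelianGroup.map_of_apply, Prod.map_apply,
        id_eq, Set.mem_setOf_eq]
    · exact Or.inl ⟨a₁, a₂, g m, rfl⟩
    · exact Or.inr (Or.inl ⟨a, g m₁, g m₂, rfl⟩)
    · exact Or.inr (Or.inr ⟨a, r, g m, rfl⟩))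

/-- Functoriality of `− ⊗_S M` : the map `A ⊗_S M → A' ⊗_S M` induced by a linear map
`f : A → A'` of right `S`-modules. -/
def lmap (M : Type u) [AddCommGroup M] [Module S M] (f : A →ₗ[Sᵐᵒᵖ] A') :
    NTensor S A M →+ NTensor S A' M :=
  QuotientAddGroup.map (tensorRels S A M) (tensorRels S A' M) (FreeAbelianGroup.map (Prod.map f id)) (by
    simp only [tensorRels]
    refine (AddSubgroup.closure_le _).2 ?_
    rintro x (⟨a₁, a₂, m, rfl⟩ | ⟨a, m₁, m₂, rfl⟩ | ⟨a, r, m, rfl⟩) <;>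
      refine SetLike.mem_coe.2 (AddSubgroup.mem_comap.2 (AddSubgroup.subset_closure ?_)) <;>
      simp only [map_sub, map_add, map_smul, FreeAbelianGroup.map_of_apply, Prod.map_apply,
        id_eq, Set.mem_setOf_eq]
    · exact Or.inl ⟨f a₁, f a₂, m, rfl⟩
    · exact Or.inr (Or.inl ⟨f a, m₁, m₂, rfl⟩)
    · exact Or.inr (Or.inr ⟨f a, r, m, rfl⟩))

end NTensor

end Tensor

section Dims

variable (S : Type u) [Ring S]

/-- A left `S`-module `M` is *flat* if tensoring with it preserves injectivity of maps of
right `S`-modules. -/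
def IsFlatMod (M : ModuleCat.{u} S) : Prop :=
  ∀ (A B : Type u) [AddCommGroup A] [Module Sᵐᵒᵖ A] [AddCommGroup B] [Module Sᵐᵒᵖ B]
    (f : A →ₗ[Sᵐᵒᵖ] B), Function.Injective f →
      Function.Injective (NTensor.lmap (↥M) f)

/-- A left `S`-module `M` is *Gorenstein flat* if there is an exact sequence
`⋯ → F (-1) → F 0 → F 1 → ⋯` of flat left `S`-modules with `M ≅ Im (F 0 → F 1)` which stays
exact after applying `I ⊗_S −` for every injective right `S`-module `I`
(a *complete flat resolution*). -/
def IsGorensteinFlat (M : ModuleCat.{u} S) : Prop :=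
  ∃ (F : ℤ → ModuleCat.{u} S) (d : ∀ n : ℤ, ↥(F n) →ₗ[S] ↥(F (n + 1))),
    (∀ n, IsFlatMod S (F n)) ∧
    (∀ n, Function.Exact (d n) (d (n + 1))) ∧
    Nonempty (↥M ≃ₗ[S] ↥(LinearMap.range (d 0))) ∧
    (∀ (I : Type u) [AddCommGroup I] [Module Sᵐᵒᵖ I], Module.Injective Sᵐᵒᵖ I →
      ∀ n, Function.Exact (NTensor.rmap I (d n)) (NTensor.rmap I (d (n + 1))))

/-- `gflatDimLE S n M` means `Gfd_S(M) ≤ n`: there is an exact sequence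
`0 → G_n → ⋯ → G_0 → M → 0` of left `S`-modules with all `G_i` Gorenstein flat. -/
def gflatDimLE : ℕ → ModuleCat.{u} S → Prop
  | 0, M => IsGorensteinFlat S M
  | n + 1, M => ∃ (K G : ModuleCat.{u} S) (ι : ↥K →ₗ[S] ↥G) (π : ↥G →ₗ[S] ↥M),
      Function.Injective ι ∧ Function.Surjective π ∧ Function.Exact ι π ∧
      IsGorensteinFlat S G ∧ gflatDimLE n K

/-- `flatDimLE S n M` means `fd_S(M) ≤ n`: there is an exact sequence
`0 → F_n → ⋯ → F_0 → M → 0` of left `S`-modules with all `F_i` flat. -/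
def flatDimLE : ℕ → ModuleCat.{u} S → Prop
  | 0, M => IsFlatMod S M
  | n + 1, M => ∃ (K F : ModuleCat.{u} S) (ι : ↥K →ₗ[S] ↥F) (π : ↥F →ₗ[S] ↥M),
      Function.Injective ι ∧ Function.Surjective π ∧ Function.Exact ι π ∧
      IsFlatMod S F ∧ flatDimLE n K

/-- `injDimLE S n M` means `id_S(M) ≤ n`: there is an exact sequence
`0 → M → I^0 → ⋯ → I^n → 0` of left `S`-modules with all `I^i` injective. -/
def injDimLE : ℕ → ModuleCat.{u} S → Prop
  | 0, M => Module.Injective S ↥M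
  | n + 1, M => ∃ (I C : ModuleCat.{u} S) (ι : ↥M →ₗ[S] ↥I) (π : ↥I →ₗ[S] ↥C),
      Function.Injective ι ∧ Function.Surjective π ∧ Function.Exact ι π ∧
      Module.Injective S ↥I ∧ injDimLE n C

/-- The Gorenstein flat dimension `Gfd_S(M) ∈ ℕ∞` of a left `S`-module `M`. -/
noncomputable def gflatDim (M : ModuleCat.{u} S) : ℕ∞ :=
  sInf {d : ℕ∞ | ∃ n : ℕ, d = n ∧ gflatDimLE S n M}

/-- The flat dimension `fd_S(M) ∈ ℕ∞` of a left `S`-module `M`. -/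
noncomputable def flatDim (M : ModuleCat.{u} S) : ℕ∞ :=
  sInf {d : ℕ∞ | ∃ n : ℕ, d = n ∧ flatDimLE S n M}

/-- The injective dimension `id_S(M) ∈ ℕ∞` of a left `S`-module `M`. -/
noncomputable def injDim (M : ModuleCat.{u} S) : ℕ∞ :=
  sInf {d : ℕ∞ | ∃ n : ℕ, d = n ∧ injDimLE S n M}

/-- The left weak Gorenstein global dimension
`l.Gwdim(S) = sup { Gfd_S(M) | M a left S-module }`.  The right weak Gorenstein global
dimension of `S` is `gorensteinWeakGlobalDim Sᵐᵒᵖ`. -/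
noncomputable def gorensteinWeakGlobalDim : ℕ∞ :=
  ⨆ M : ModuleCat.{u} S, gflatDim S M

/-- The left weak global dimension `sup { fd_S(M) | M a left S-module }`.  (By a classical
theorem it agrees with `weakGlobalDim Sᵐᵒᵖ`, and the common value is `wdim S`.) -/
noncomputable def weakGlobalDim : ℕ∞ :=
  ⨆ M : ModuleCat.{u} S, flatDim S M

/-- The left finitistic flat dimension
`l.FFD(S) = sup { fd_S(M) | M a left S-module with fd_S(M) < ∞ }`. -/
noncomputable def finitisticFlatDim : ℕ∞ :=
  sSup {d : ℕ∞ | d ≠ ⊤ ∧ ∃ M : ModuleCat.{u} S, flatDim S M = d}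

/-- The left finitistic Gorenstein flat dimension
`l.FGFD(S) = sup { Gfd_S(M) | M a left S-module with Gfd_S(M) < ∞ }`. -/
noncomputable def finitisticGFlatDim : ℕ∞ :=
  sSup {d : ℕ∞ | d ≠ ⊤ ∧ ∃ M : ModuleCat.{u} S, gflatDim S M = d}

/-- A ring `S` is *left GF-closed* if the class of Gorenstein flat left `S`-modules is closed
under extensions.  `S` is right GF-closed iff `Sᵐᵒᵖ` is left GF-closed, and GF-closed if both. -/
def IsGFClosed : Prop :=
  ∀ (A B C : ModuleCat.{u} S) (f : ↥A →ₗ[S] ↥B) (g : ↥B →ₗ[S] ↥C),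
    Function.Injective f → Function.Surjective g → Function.Exact f g →
      IsGorensteinFlat S A → IsGorensteinFlat S C → IsGorensteinFlat S B

/-- A ring `S` is *left coherent* if every finitely generated left ideal of `S` is finitely
presented (as a left `S`-module).  `S` is right coherent iff `Sᵐᵒᵖ` is left coherent. -/
def IsLeftCoherent : Prop :=
  ∀ I : Submodule S S, I.FG → Module.FinitePresentation S ↥I

/-- A ring `S` is *left IF* if every injective left `S`-module is flat.  `S` is right IF iff
`Sᵐᵒᵖ` is left IF, and IF if both. -/
def IsLeftIF : Prop :=
  ∀ E : ModuleCat.{u} S, Module.Injective S ↥E → IsFlatMod S E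

/-- A ring `S` is *left `n`-IF* if `fd_S(E) ≤ n` for every injective left `S`-module `E`.
`S` is right `n`-IF iff `Sᵐᵒᵖ` is left `n`-IF, and `n`-IF if both. -/
def IsLeftNIF (n : ℕ) : Prop :=
  ∀ E : ModuleCat.{u} S, Module.Injective S ↥E → flatDim S E ≤ (n : ℕ∞)

/-- `Ext¹_S(T, K) = 0`, expressed by its standard characterization: every extension of `T`
by `K` (i.e. every short exact sequence `0 → K → X → T → 0`) splits. -/
def Ext1Zero (T K : ModuleCat.{u} S) : Prop :=
  ∀ (X : ModuleCat.{u} S) (ι : ↥K →ₗ[S] ↥X) (π : ↥X →ₗ[S] ↥T),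
    Function.Injective ι → Function.Surjective π → Function.Exact ι π →
      ∃ ρ : ↥X →ₗ[S] ↥K, ρ.comp ι = LinearMap.id

/-- A left `S`-module `K` is *cotorsion* if `Ext¹_S(F, K) = 0` for every flat left
`S`-module `F`. -/
def IsCotorsion (K : ModuleCat.{u} S) : Prop :=
  ∀ F : ModuleCat.{u} S, IsFlatMod S F → Ext1Zero S F K

/-- `Tor₁^S(A, T) = 0` for a right `S`-module `A` and a left `S`-module `T`, expressed by its
standard characterization: for every short exact sequence `0 → K → F → T → 0` of left
`S`-modules with `F` flat, the induced map `A ⊗_S K → A ⊗_S F` is injective. -/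
def Tor1Zero (A : Type u) [AddCommGroup A] [Module Sᵐᵒᵖ A] (T : ModuleCat.{u} S) : Prop :=
  ∀ (K F : ModuleCat.{u} S) (ι : ↥K →ₗ[S] ↥F) (π : ↥F →ₗ[S] ↥T),
    IsFlatMod S F → Function.Injective ι → Function.Surjective π → Function.Exact ι π →
      Function.Injective (NTensor.rmap A ι)

/-- A left `S`-module is *finitely presented* if it admits a presentation with finitely many
generators and relations. -/
abbrev IsFinitelyPresented (M : ModuleCat.{u} S) : Prop :=
  Module.FinitePresentation S ↥M

end Dims

section Duality

/-- The character group of a right module `A`, as a left module. -/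
def LeftDual (_S : Type u) (A : Type u) [AddCommGroup A] : Type u :=
  A →+ AddCircle (1 : ℚ)

/-- The character group of a left module `M`, as a right module. -/
def RightDual (_S : Type u) (M : Type u) [AddCommGroup M] : Type u :=
  M →+ AddCircle (1 : ℚ)

instance (S : Type u) (A : Type u) [AddCommGroup A] : AddCommGroup (LeftDual S A) :=
  inferInstanceAs (AddCommGroup (A →+ AddCircle (1 : ℚ)))

instance (S : Type u) (A : Type u) [AddCommGroup A] :
    FunLike (LeftDual S A) A (AddCircle (1 : ℚ)) :=
  inferInstanceAs (FunLike (A →+ AddCircle (1 : ℚ)) _ _)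

instance (S : Type u) (A : Type u) [AddCommGroup A] :
    AddMonoidHomClass (LeftDual S A) A (AddCircle (1 : ℚ)) :=
  inferInstanceAs (AddMonoidHomClass (A →+ AddCircle (1 : ℚ)) _ _)

instance (S : Type u) (M : Type u) [AddCommGroup M] : AddCommGroup (RightDual S M) :=
  inferInstanceAs (AddCommGroup (M →+ AddCircle (1 : ℚ)))

instance (S : Type u) (M : Type u) [AddCommGroup M] :
    FunLike (RightDual S M) M (AddCircle (1 : ℚ)) :=
  inferInstanceAs (FunLike (M →+ AddCircle (1 : ℚ)) _ _)

instance (S : Type u) (M : Type u) [AddCommGroup M] :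
    AddMonoidHomClass (RightDual S M) M (AddCircle (1 : ℚ)) :=
  inferInstanceAs (AddMonoidHomClass (M →+ AddCircle (1 : ℚ)) _ _)

@[ext] theorem LeftDual.ext {S A : Type u} [AddCommGroup A]
    {f g : LeftDual S A} (h : ∀ a, f a = g a) : f = g := DFunLike.ext _ _ h

@[simp] theorem LeftDual.add_apply {S A : Type u} [AddCommGroup A]
    (f g : LeftDual S A) (a : A) : (f + g) a = f a + g a := rfl

@[simp] theorem LeftDual.zero_apply {S A : Type u} [AddCommGroup A]
    (a : A) : (0 : LeftDual S A) a = 0 := rfl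

@[ext] theorem RightDual.ext {S M : Type u} [AddCommGroup M]
    {f g : RightDual S M} (h : ∀ m, f m = g m) : f = g := DFunLike.ext _ _ h

@[simp] theorem RightDual.add_apply {S M : Type u} [AddCommGroup M]
    (f g : RightDual S M) (m : M) : (f + g) m = f m + g m := rfl

@[simp] theorem RightDual.sub_apply {S M : Type u} [AddCommGroup M]
    (f g : RightDual S M) (m : M) : (f - g) m = f m - g m := rfl

@[simp] theorem RightDual.zero_apply {S M : Type u} [AddCommGroup M]
    (m : M) : (0 : RightDual S M) m = 0 := rfl

variable {S : Type u} [Ring S]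
variable {A B : Type u} [AddCommGroup A] [Module Sᵐᵒᵖ A] [AddCommGroup B] [Module Sᵐᵒᵖ B]
variable {M N P : Type u} [AddCommGroup M] [Module S M] [AddCommGroup N] [Module S N]
  [AddCommGroup P] [Module S P]

instance : Module S (LeftDual S A) where
  smul r f := AddMonoidHom.comp f (DistribSMul.toAddMonoidHom A (op r))
  one_smul f := DFunLike.ext _ _ fun a => congrArg f (one_smul Sᵐᵒᵖ a)
  mul_smul r s f := DFunLike.ext _ _ fun a => congrArg f (mul_smul (op s) (op r) a)
  smul_zero _ := rfl
  smul_add _ _ _ := rfl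
  add_smul r s f := DFunLike.ext _ _ fun a =>
    (congrArg f (add_smul (op r) (op s) a)).trans (map_add f _ _)
  zero_smul f := DFunLike.ext _ _ fun a => (congrArg f (zero_smul Sᵐᵒᵖ a)).trans (map_zero f)

instance : Module Sᵐᵒᵖ (RightDual S M) where
  smul r f := AddMonoidHom.comp f (DistribSMul.toAddMonoidHom M r.unop)
  one_smul f := DFunLike.ext _ _ fun a => congrArg f (one_smul S a)
  mul_smul r s f := DFunLike.ext _ _ fun a => congrArg f (mul_smul s.unop r.unop a)
  smul_zero _ := rfl
  smul_add _ _ _ := rfl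
  add_smul r s f := DFunLike.ext _ _ fun a =>
    (congrArg f (add_smul r.unop s.unop a)).trans (map_add f _ _)
  zero_smul f := DFunLike.ext _ _ fun a => (congrArg f (zero_smul S a)).trans (map_zero f)

namespace LeftDual

@[simp] theorem smul_apply (r : S) (f : LeftDual S A) (a : A) : (r • f) a = f (op r • a) := rfl

/-- The transpose of a homomorphism of right modules. -/
def map (f : A →ₗ[Sᵐᵒᵖ] B) : LeftDual S B →ₗ[S] LeftDual S A where
  toFun c := AddMonoidHom.comp c f.toAddMonoidHom
  map_add' _ _ := rfl
  map_smul' r c := DFunLike.ext _ _ fun a => congrArg c (f.map_smul (op r) a).symm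

@[simp] theorem map_apply (f : A →ₗ[Sᵐᵒᵖ] B) (c : LeftDual S B) (a : A) :
    map f c a = c (f a) := rfl

end LeftDual

namespace RightDual

/-- The transpose of a homomorphism of left modules. -/
def map (f : M →ₗ[S] N) : RightDual S N →ₗ[Sᵐᵒᵖ] RightDual S M where
  toFun c := AddMonoidHom.comp c f.toAddMonoidHom
  map_add' _ _ := rfl
  map_smul' r c := DFunLike.ext _ _ fun a => congrArg c (f.map_smul r.unop a).symm

@[simp] theorem map_apply (f : M →ₗ[S] N) (c : RightDual S N) (m : M) :
    map f c m = c (f m) := rfl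

end RightDual

/-- Homomorphisms `M → A⁺` of left modules correspond to homomorphisms `A → M⁺` of right
modules. -/
def dualFlip : (M →ₗ[S] LeftDual S A) ≃ (A →ₗ[Sᵐᵒᵖ] RightDual S M) where
  toFun φ :=
    { toFun := fun a =>
        ({ toFun := fun m => φ m a, map_zero' := by simp, map_add' := by simp } :
          M →+ AddCircle (1 : ℚ))
      map_add' := fun a b => RightDual.ext fun m => map_add (φ m) a b
      map_smul' := fun r a => RightDual.ext fun m =>
        (DFunLike.congr_fun (φ.map_smul r.unop m) a).symm }
  invFun ψ :=
    { toFun := fun m =>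
        ({ toFun := fun a => ψ a m, map_zero' := by simp, map_add' := by simp } :
          A →+ AddCircle (1 : ℚ))
      map_add' := fun a b => LeftDual.ext fun m => map_add (ψ m) a b
      map_smul' := fun r a => LeftDual.ext fun m =>
        (DFunLike.congr_fun (ψ.map_smul (op r) m) a).symm }
  left_inv _ := rfl
  right_inv _ := rfl

namespace NTensor

variable (S A M) in
/-- The quotient map from the free abelian group on `A × M` to `A ⊗ M`. -/
def mkHom : FreeAbelianGroup (A × M) →+ NTensor S A M :=
  QuotientAddGroup.mk' (tensorRels S A M)

/-- The elementary tensor `a ⊗ m`. -/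
def tmul (a : A) (m : M) : NTensor S A M :=
  mkHom S A M (FreeAbelianGroup.of (a, m))

theorem mkHom_eq_of_sub_mem {x y : FreeAbelianGroup (A × M)} (h : x - y ∈ tensorRels S A M) :
    mkHom S A M x = mkHom S A M y := by
  rw [← sub_eq_zero, ← map_sub]
  exact (QuotientAddGroup.eq_zero_iff _).2 h

theorem add_tmul (a b : A) (m : M) : (tmul (a + b) m : NTensor S A M) = tmul a m + tmul b m := by
  rw [tmul, tmul, tmul, ← map_add]
  refine mkHom_eq_of_sub_mem (AddSubgroup.subset_closure (Or.inl ⟨a, b, m, ?_⟩))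
  abel

theorem tmul_add (a : A) (m n : M) : (tmul a (m + n) : NTensor S A M) = tmul a m + tmul a n := by
  rw [tmul, tmul, tmul, ← map_add]
  refine mkHom_eq_of_sub_mem (AddSubgroup.subset_closure (Or.inr (Or.inl ⟨a, m, n, ?_⟩)))
  abel

theorem smul_tmul (r : S) (a : A) (m : M) :
    (tmul (op r • a) m : NTensor S A M) = tmul a (r • m) :=
  mkHom_eq_of_sub_mem (AddSubgroup.subset_closure (Or.inr (Or.inr ⟨a, r, m, rfl⟩)))

@[simp] theorem rmap_tmul (g : M →ₗ[S] N) (a : A) (m : M) :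
    rmap A g (tmul a m) = tmul a (g m) := by
  change mkHom S A N
    (FreeAbelianGroup.map (Prod.map id g) (FreeAbelianGroup.of (a, m))) = _
  rw [FreeAbelianGroup.map_of_apply]
  rfl

@[simp] theorem lmap_tmul (f : A →ₗ[Sᵐᵒᵖ] B) (a : A) (m : M) :
    lmap M f (tmul a m) = tmul (f a) m := by
  change mkHom S B M
    (FreeAbelianGroup.map (Prod.map f id) (FreeAbelianGroup.of (a, m))) = _
  rw [FreeAbelianGroup.map_of_apply]
  rfl

theorem addHom_ext {X : Type*} [AddCommGroup X] {f g : NTensor S A M →+ X}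
    (h : ∀ a m, f (tmul a m) = g (tmul a m)) : f = g := by
  refine QuotientAddGroup.addMonoidHom_ext _ (FreeAbelianGroup.lift_ext _ _ fun x => ?_)
  exact h x.1 x.2

theorem induction_on {p : NTensor S A M → Prop} (x : NTensor S A M)
    (zero : p 0) (neg : ∀ a m, p (tmul a m) → p (-tmul a m)) (tmul : ∀ a m, p (tmul a m))
    (add : ∀ x y, p x → p y → p (x + y)) : p x := by
  obtain ⟨y, rfl⟩ := QuotientAddGroup.mk'_surjective _ x
  induction y using FreeAbelianGroup.induction_on with
  | zero => exact zero
  | of x => exact tmul x.1 x.2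
  | neg x hx => exact neg x.1 x.2 hx
  | add x y hx hy => exact add _ _ hx hy

/-- Characters of `A ⊗ M` correspond to homomorphisms `M → A⁺`. -/
def characterEquiv : (NTensor S A M →+ AddCircle (1 : ℚ)) ≃ (M →ₗ[S] LeftDual S A) where
  toFun c :=
    { toFun := fun m =>
        (AddMonoidHom.mk' (fun a => c (tmul a m))
          (fun a b => by rw [add_tmul, map_add]) : A →+ AddCircle (1 : ℚ))
      map_add' := fun m n => LeftDual.ext fun a =>
        (congrArg c (tmul_add a m n)).trans (map_add c _ _)
      map_smul' := fun r m => LeftDual.ext fun a => (congrArg c (smul_tmul r a m)).symm }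
  invFun φ := QuotientAddGroup.lift (tensorRels S A M)
    (FreeAbelianGroup.lift fun x => φ x.2 x.1) (by
      refine (AddSubgroup.closure_le _).2 ?_
      rintro x (⟨a₁, a₂, m, rfl⟩ | ⟨a, m₁, m₂, rfl⟩ | ⟨a, r, m, rfl⟩) <;>
        simp [AddMonoidHom.mem_ker])
  left_inv c := addHom_ext fun a m => by
    exact FreeAbelianGroup.lift_apply_of _ _
  right_inv φ := by
    ext m a
    exact FreeAbelianGroup.lift_apply_of _ _

@[simp] theorem characterEquiv_apply (c : NTensor S A M →+ AddCircle (1 : ℚ)) (m : M) (a : A) :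
    characterEquiv c m a = c (tmul a m) := rfl

theorem characterEquiv_comp_rmap (g : M →ₗ[S] N) (c : NTensor S A N →+ AddCircle (1 : ℚ)) :
    characterEquiv (c.comp (rmap A g)) = (characterEquiv c).comp g := by
  ext m a
  simp

theorem characterEquiv_comp_lmap (f : A →ₗ[Sᵐᵒᵖ] B) (c : NTensor S B M →+ AddCircle (1 : ℚ)) :
    characterEquiv (c.comp (lmap M f)) = (LeftDual.map f).comp (characterEquiv c) := by
  ext m a
  simp

end NTensor

theorem AddMonoidHom.exists_character_comp_eq {X Y : Type u} [AddCommGroup X] [AddCommGroup Y]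
    {f : X →+ Y} (hf : Function.Injective f) (c : X →+ AddCircle (1 : ℚ)) :
    ∃ c' : Y →+ AddCircle (1 : ℚ), c'.comp f = c :=
  CharacterModule.dual_surjective_of_injective f.toIntLinearMap hf c

theorem AddMonoidHom.injective_iff_character {X Y : Type u} [AddCommGroup X] [AddCommGroup Y]
    (f : X →+ Y) : Function.Injective f ↔
      ∀ c : X →+ AddCircle (1 : ℚ), ∃ c' : Y →+ AddCircle (1 : ℚ), c'.comp f = c := by
  refine ⟨fun hf => exists_character_comp_eq hf, fun h => ?_⟩
  refine (injective_iff_map_eq_zero f).2 fun x hx => ?_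
  refine CharacterModule.eq_zero_of_character_apply fun c => ?_
  obtain ⟨c', rfl⟩ := h c
  exact (congrArg c' hx).trans (map_zero c')

theorem AddMonoidHom.exact_iff_character {X Y Z : Type u} [AddCommGroup X] [AddCommGroup Y]
    [AddCommGroup Z] (f : X →+ Y) (g : Y →+ Z) : Function.Exact f g ↔ g.comp f = 0 ∧
      ∀ c : Y →+ AddCircle (1 : ℚ), c.comp f = 0 →
        ∃ c' : Z →+ AddCircle (1 : ℚ), c'.comp g = c := by
  constructor
  · intro h
    refine ⟨h.addMonoidHom_comp_eq_zero, fun c hc => ?_⟩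
    have hle : g.ker ≤ c.ker := fun y hy => by
      obtain ⟨x, rfl⟩ := (h y).1 hy
      exact DFunLike.congr_fun hc x
    obtain ⟨c', hc'⟩ := exists_character_comp_eq (QuotientAddGroup.kerLift_injective g)
      (QuotientAddGroup.lift g.ker c hle)
    exact ⟨c', AddMonoidHom.ext fun y => DFunLike.congr_fun hc' (QuotientAddGroup.mk y)⟩
  · rintro ⟨h0, h⟩ y
    constructor
    · intro hy
      suffices QuotientAddGroup.mk' f.range y = 0 from (QuotientAddGroup.eq_zero_iff y).1 this
      refine CharacterModule.eq_zero_of_character_apply fun c => ?_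
      obtain ⟨c', hc'⟩ := h (AddMonoidHom.comp c (QuotientAddGroup.mk' f.range)) (by
        ext x
        have : QuotientAddGroup.mk' f.range (f x) = 0 :=
          (QuotientAddGroup.eq_zero_iff _).2 ⟨x, rfl⟩
        exact (congrArg c this).trans (map_zero c))
      have := DFunLike.congr_fun hc' y
      exact this.symm.trans ((congrArg c' hy).trans (map_zero c'))
    · rintro ⟨x, rfl⟩
      exact DFunLike.congr_fun h0 x

theorem NTensor.rmap_injective_iff (g : M →ₗ[S] N) :
    Function.Injective (rmap A g) ↔
      ∀ φ : M →ₗ[S] LeftDual S A, ∃ ψ : N →ₗ[S] LeftDual S A, ψ.comp g = φ := by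
  rw [AddMonoidHom.injective_iff_character, ← characterEquiv.forall_congr_right]
  refine forall_congr' fun c => ?_
  rw [← characterEquiv.exists_congr_right]
  simp only [← characterEquiv_comp_rmap, characterEquiv.injective.eq_iff]

theorem NTensor.lmap_injective_iff (f : A →ₗ[Sᵐᵒᵖ] B) :
    Function.Injective (lmap M f) ↔
      ∀ φ : M →ₗ[S] LeftDual S A, ∃ ψ : M →ₗ[S] LeftDual S B, (LeftDual.map f).comp ψ = φ := by
  rw [AddMonoidHom.injective_iff_character, ← characterEquiv.forall_congr_right]
  refine forall_congr' fun c => ?_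
  rw [← characterEquiv.exists_congr_right]
  simp only [← characterEquiv_comp_lmap, characterEquiv.injective.eq_iff]

theorem NTensor.rmap_exact_iff {f : M →ₗ[S] N} {g : N →ₗ[S] P} (hfg : g.comp f = 0) :
    Function.Exact (rmap A f) (rmap A g) ↔
      ∀ φ : N →ₗ[S] LeftDual S A, φ.comp f = 0 →
        ∃ ψ : P →ₗ[S] LeftDual S A, ψ.comp g = φ := by
  have h0 : (rmap A g).comp (rmap A f) = 0 := addHom_ext fun a m => by
    have h1 : g (f m) = 0 := DFunLike.congr_fun hfg m
    have h2 : (tmul a (0 : P) : NTensor S A P) = 0 := by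
      simpa using tmul_add (S := S) a (0 : P) 0
    simp [h1, h2]
  have hz : ∀ c : NTensor S A M →+ AddCircle (1 : ℚ), characterEquiv c = 0 ↔ c = 0 := by
    intro c
    rw [← characterEquiv.injective.eq_iff]
    rfl
  rw [AddMonoidHom.exact_iff_character, and_iff_right h0, ← characterEquiv.forall_congr_right]
  refine forall_congr' fun c => ?_
  rw [← characterEquiv.exists_congr_right, ← characterEquiv_comp_rmap, hz]
  simp only [← characterEquiv_comp_rmap, characterEquiv.injective.eq_iff]

theorem isFlatMod_iff_injective_rightDual (M : ModuleCat.{u} S) :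
    IsFlatMod S M ↔ Module.Injective Sᵐᵒᵖ (RightDual S M) := by
  constructor
  · intro h
    refine ⟨fun A B _ _ _ _ f hf g => ?_⟩
    obtain ⟨ψ, hψ⟩ := (NTensor.lmap_injective_iff f).1 (h A B f hf) (dualFlip.symm g)
    exact ⟨dualFlip ψ, fun a => RightDual.ext fun m =>
      DFunLike.congr_fun (DFunLike.congr_fun hψ m) a⟩
  · intro h A B _ _ _ _ f hf
    refine (NTensor.lmap_injective_iff f).2 fun φ => ?_
    obtain ⟨ψ, hψ⟩ := h.out f hf (dualFlip φ)
    exact ⟨dualFlip.symm ψ, LinearMap.ext fun m => LeftDual.ext fun a =>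
      DFunLike.congr_fun (hψ a) m⟩

theorem LeftDual.map_surjective {f : A →ₗ[Sᵐᵒᵖ] B} (hf : Function.Injective f) :
    Function.Surjective (LeftDual.map f) := fun c =>
  AddMonoidHom.exists_character_comp_eq (f := f.toAddMonoidHom) hf c

theorem RightDual.map_surjective {f : M →ₗ[S] N} (hf : Function.Injective f) :
    Function.Surjective (RightDual.map f) := fun c =>
  AddMonoidHom.exists_character_comp_eq (f := f.toAddMonoidHom) hf c

theorem LeftDual.map_exact {C : Type u} [AddCommGroup C] [Module Sᵐᵒᵖ C] {f : A →ₗ[Sᵐᵒᵖ] B}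
    {g : B →ₗ[Sᵐᵒᵖ] C} (h : Function.Exact f g) :
    Function.Exact (LeftDual.map g) (LeftDual.map f) := fun c =>
  ⟨fun hc => ((AddMonoidHom.exact_iff_character f.toAddMonoidHom g.toAddMonoidHom).1 h).2 c hc,
    by rintro ⟨c', rfl⟩; ext a; simp [h.apply_apply_eq_zero]⟩

theorem LeftDual.map_injective {f : A →ₗ[Sᵐᵒᵖ] B} (hf : Function.Surjective f) :
    Function.Injective (LeftDual.map f) := fun c c' h => LeftDual.ext fun b => by
  obtain ⟨a, rfl⟩ := hf b
  exact DFunLike.congr_fun h a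

/-- The dual of a projective right module is injective. -/
theorem LeftDual.injective_of_projective [Module.Projective Sᵐᵒᵖ A] :
    Module.Injective S (LeftDual S A) := by
  refine ⟨fun X Y _ _ _ _ f hf g => ?_⟩
  obtain ⟨ψ, hψ⟩ := Module.projective_lifting_property (RightDual.map f) (dualFlip g)
    (RightDual.map_surjective hf)
  exact ⟨dualFlip.symm ψ, fun x => LeftDual.ext fun a =>
    DFunLike.congr_fun (DFunLike.congr_fun hψ a) x⟩

theorem IsFlatMod.of_projective (M : ModuleCat.{u} S) [Module.Projective S M] : IsFlatMod S M :=
  fun _ _ _ _ _ _ f hf => (NTensor.lmap_injective_iff f).2 fun φ =>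
    Module.projective_lifting_property (LeftDual.map f) φ (LeftDual.map_surjective hf)

end Duality

section ExtVanishing

open CategoryTheory Abelian

variable {R : Type u} [Ring R]

/-- The sequence `0 → K → G → M → 0` given by `f` and `g` is exact. -/
structure IsShortExact {K G M : ModuleCat.{u} R} (f : K →ₗ[R] G) (g : G →ₗ[R] M) : Prop where
  injective : Function.Injective f
  surjective : Function.Surjective g
  exact : Function.Exact f g

/-- `Extⁱ(M, X) = 0`. -/
abbrev ExtVanishes (M X : ModuleCat.{u} R) (i : ℕ) : Prop :=
  Subsingleton (Ext.{u} M X i)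

namespace IsShortExact

variable {K G M : ModuleCat.{u} R} {f : K →ₗ[R] G} {g : G →ₗ[R] M}

/-- The short complex attached to a short exact sequence of modules. -/
abbrev shortComplex (h : IsShortExact f g) : ShortComplex (ModuleCat.{u} R) where
  X₁ := K
  X₂ := G
  X₃ := M
  f := ModuleCat.ofHom f
  g := ModuleCat.ofHom g
  zero := ModuleCat.hom_ext h.exact.linearMap_comp_eq_zero

theorem shortExact (h : IsShortExact f g) : h.shortComplex.ShortExact :=
  ModuleCat.shortComplex_shortExact _ h.exact h.injective h.surjective

theorem extVanishes_left (h : IsShortExact f g) {X : ModuleCat.{u} R} {i : ℕ}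
    (hG : ExtVanishes G X i) (hM : ExtVanishes M X (i + 1)) : ExtVanishes K X i := by
  refine subsingleton_of_forall_eq 0 fun x => ?_
  obtain ⟨y, rfl⟩ := Ext.contravariant_sequence_exact₁ h.shortExact X x (add_comm 1 i)
    (hM.elim _ _)
  rw [hG.elim y 0]
  exact Ext.comp_zero ..

theorem extVanishes_right (h : IsShortExact f g) {X : ModuleCat.{u} R} {i : ℕ}
    (hK : ExtVanishes K X i) (hG : ExtVanishes G X (i + 1)) : ExtVanishes M X (i + 1) := by
  refine subsingleton_of_forall_eq 0 fun x => ?_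
  obtain ⟨y, rfl⟩ := Ext.contravariant_sequence_exact₃ h.shortExact X x
    (hG.elim _ _) (add_comm 1 i)
  rw [hK.elim y 0]
  exact Ext.comp_zero ..

theorem extVanishes_mid (h : IsShortExact f g) {X : ModuleCat.{u} R} {i : ℕ}
    (hK : ExtVanishes K X i) (hM : ExtVanishes M X i) : ExtVanishes G X i := by
  refine subsingleton_of_forall_eq 0 fun x => ?_
  obtain ⟨y, rfl⟩ := Ext.contravariant_sequence_exact₂ h.shortExact X x (hK.elim _ _)
  rw [hM.elim y 0]
  exact Ext.comp_zero ..

theorem exists_extension (h : IsShortExact f g) {X : ModuleCat.{u} R}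
    (hM : ExtVanishes M X 1) (φ : K →ₗ[R] X) : ∃ ψ : G →ₗ[R] X, ψ.comp f = φ := by
  obtain ⟨y, hy⟩ := Ext.contravariant_sequence_exact₁ h.shortExact X
    (Ext.mk₀ (ModuleCat.ofHom φ)) (add_comm 1 0) (hM.elim _ _)
  obtain ⟨ψ, rfl⟩ := Ext.addEquiv₀.symm.surjective y
  refine ⟨ψ.hom, ?_⟩
  have := Ext.addEquiv₀.symm.injective ((Ext.mk₀_comp_mk₀ (ModuleCat.ofHom f) ψ).symm.trans hy)
  exact congrArg ModuleCat.Hom.hom this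

theorem extVanishes_one (h : IsShortExact f g) {X : ModuleCat.{u} R}
    (hG : ExtVanishes G X 1) (hext : ∀ φ : K →ₗ[R] X, ∃ ψ : G →ₗ[R] X, ψ.comp f = φ) :
    ExtVanishes M X 1 := by
  refine subsingleton_of_forall_eq 0 fun x => ?_
  obtain ⟨y, rfl⟩ := Ext.contravariant_sequence_exact₃ h.shortExact X x
    (hG.elim _ _) (add_comm 1 0)
  obtain ⟨φ, rfl⟩ := Ext.addEquiv₀.symm.surjective y
  obtain ⟨ψ, hψ⟩ := hext φ.hom
  have : Ext.addEquiv₀.symm φ = (Ext.mk₀ (ModuleCat.ofHom f)).comp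
      (Ext.mk₀ (ModuleCat.ofHom ψ)) (add_zero 0) := by
    rw [Ext.mk₀_comp_mk₀]
    exact congrArg Ext.mk₀ (ModuleCat.hom_ext hψ.symm)
  rw [this]
  exact h.shortExact.extClass_comp_assoc _

theorem extVanishes_of_cokernel (h : IsShortExact f g) {X : ModuleCat.{u} R} {i : ℕ}
    (hM : ExtVanishes X M i) (hG : ExtVanishes X G (i + 1)) : ExtVanishes X K (i + 1) := by
  refine subsingleton_of_forall_eq 0 fun x => ?_
  obtain ⟨y, rfl⟩ := Ext.covariant_sequence_exact₁ X h.shortExact x (hG.elim _ _) rfl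
  rw [hM.elim y 0]
  exact Ext.zero_comp ..

theorem extVanishes_cokernel (h : IsShortExact f g) {X : ModuleCat.{u} R} {i : ℕ}
    (hK : ExtVanishes X K (i + 1)) (hG : ExtVanishes X G i) : ExtVanishes X M i := by
  refine subsingleton_of_forall_eq 0 fun x => ?_
  obtain ⟨y, rfl⟩ := Ext.covariant_sequence_exact₃ X h.shortExact x rfl (hK.elim _ _)
  rw [hG.elim y 0]
  exact Ext.zero_comp ..

theorem extVanishes_one_of_lift (h : IsShortExact f g) {X : ModuleCat.{u} R}
    (hG : ExtVanishes X G 1) (hlift : ∀ φ : X →ₗ[R] M, ∃ ψ : X →ₗ[R] G, g.comp ψ = φ) :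
    ExtVanishes X K 1 := by
  refine subsingleton_of_forall_eq 0 fun x => ?_
  obtain ⟨y, rfl⟩ := Ext.covariant_sequence_exact₁ X h.shortExact x (hG.elim _ _) rfl
  obtain ⟨φ, rfl⟩ := Ext.addEquiv₀.symm.surjective y
  obtain ⟨ψ, hψ⟩ := hlift φ.hom
  have : Ext.addEquiv₀.symm φ = (Ext.mk₀ (ModuleCat.ofHom ψ)).comp
      (Ext.mk₀ (ModuleCat.ofHom g)) (add_zero 0) := by
    rw [Ext.mk₀_comp_mk₀]
    exact congrArg Ext.mk₀ (ModuleCat.hom_ext hψ.symm)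
  rw [this, Ext.comp_assoc_of_second_deg_zero]
  exact (congrArg (Ext.comp (Ext.mk₀ (ModuleCat.ofHom ψ)) · (zero_add 1))
    h.shortExact.comp_extClass).trans (Ext.comp_zero ..)

end IsShortExact

theorem extVanishes_of_injective (M X : ModuleCat.{u} R) (hX : Module.Injective R X) (i : ℕ) :
    ExtVanishes M X (i + 1) :=
  have : Injective X := Module.injective_object_of_injective_module R X
  Ext.subsingleton_of_injective M X i

variable (R) in
/-- The left dual of a right module, as an object of the category of left modules. -/
abbrev leftDualObj (A : Type u) [AddCommGroup A] [Module Rᵐᵒᵖ A] : ModuleCat.{u} R :=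
  ModuleCat.of R (LeftDual R A)

/-- The dual of a free presentation of a right module. -/
theorem exists_isShortExact_leftDual (A : Type u) [AddCommGroup A] [Module Rᵐᵒᵖ A] :
    ∃ (Q : Type u) (_ : AddCommGroup Q) (_ : Module Rᵐᵒᵖ Q) (B : Submodule Rᵐᵒᵖ Q)
      (f : leftDualObj R A →ₗ[R] leftDualObj R Q),
      Module.Injective R (LeftDual R Q) ∧
        IsShortExact (M := leftDualObj R B) f (LeftDual.map B.subtype) := by
  let p : (A →₀ Rᵐᵒᵖ) →ₗ[Rᵐᵒᵖ] A := Finsupp.linearCombination Rᵐᵒᵖ id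
  have hp : Function.Surjective p := Finsupp.linearCombination_id_surjective Rᵐᵒᵖ A
  refine ⟨A →₀ Rᵐᵒᵖ, inferInstance, inferInstance, p.ker, LeftDual.map p,
    LeftDual.injective_of_projective, ?_⟩
  exact ⟨LeftDual.map_injective hp, LeftDual.map_surjective p.ker.injective_subtype,
    LeftDual.map_exact p.exact_subtype_ker_map⟩

theorem IsFlatMod.extVanishes_leftDual {F : ModuleCat.{u} R} (hF : IsFlatMod R F) (i : ℕ) :
    ∀ (A : Type u) [AddCommGroup A] [Module Rᵐᵒᵖ A],
      ExtVanishes F (leftDualObj R A) (i + 1) := by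
  induction i with
  | zero =>
    intro A _ _
    obtain ⟨Q, _, _, B, f, hQ, h⟩ := exists_isShortExact_leftDual (R := R) A
    exact h.extVanishes_one_of_lift (extVanishes_of_injective _ _ hQ 0)
      ((NTensor.lmap_injective_iff _).1 (hF B Q B.subtype B.injective_subtype))
  | succ i ih =>
    intro A _ _
    obtain ⟨Q, _, _, B, f, hQ, h⟩ := exists_isShortExact_leftDual (R := R) A
    exact h.extVanishes_of_cokernel (ih B) (extVanishes_of_injective _ _ hQ _)

/-- Dimension shifting in the second variable: `Extⁿ⁺ⁱ(-, A⁺)` vanishes together with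
`Extⁱ(-, B⁺)` for a suitable syzygy `B` of `A`. -/
theorem exists_extVanishes_leftDual_iff (n : ℕ) :
    ∀ (A : Type u) [AddCommGroup A] [Module Rᵐᵒᵖ A],
      ∃ (B : Type u) (_ : AddCommGroup B) (_ : Module Rᵐᵒᵖ B), ∀ (M : ModuleCat.{u} R) (i : ℕ),
        ExtVanishes M (leftDualObj R A) (n + i + 1) ↔
          ExtVanishes M (leftDualObj R B) (i + 1) := by
  induction n with
  | zero =>
    intro A _ _
    exact ⟨A, inferInstance, inferInstance, fun M i => by rw [zero_add]⟩
  | succ n ih =>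
    intro A _ _
    obtain ⟨Q, _, _, B, f, hQ, h⟩ := exists_isShortExact_leftDual (R := R) A
    obtain ⟨C, _, _, hC⟩ := ih B
    refine ⟨C, inferInstance, inferInstance, fun M i => ?_⟩
    rw [← hC M i, show n + 1 + i + 1 = (n + i + 1) + 1 by ring]
    exact ⟨fun hA => h.extVanishes_cokernel hA (extVanishes_of_injective _ _ hQ _),
      fun hB => h.extVanishes_of_cokernel hB (extVanishes_of_injective _ _ hQ _)⟩

theorem NTensor.rmap_rmap {A M N P : Type u} [AddCommGroup A] [Module Rᵐᵒᵖ A] [AddCommGroup M]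
    [Module R M] [AddCommGroup N] [Module R N] [AddCommGroup P] [Module R P]
    (f : M →ₗ[R] N) (g : N →ₗ[R] P) (x : NTensor R A M) :
    rmap A g (rmap A f x) = rmap A (g.comp f) x :=
  DFunLike.congr_fun (addHom_ext (f := (rmap A g).comp (rmap A f)) (g := rmap A (g.comp f))
    fun a m => by simp) x

/-- An element of `A ⊗ N` comes from `A ⊗ N₀` for some finitely generated `N₀ ≤ N`. -/
theorem NTensor.exists_fg_rmap_eq {A M : Type u} [AddCommGroup A] [Module Rᵐᵒᵖ A]
    [AddCommGroup M] [Module R M] {N : Submodule R M} (x : NTensor R A N) :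
    ∃ (N₀ : Submodule R M) (hN₀ : N₀ ≤ N) (x₀ : NTensor R A N₀), N₀.FG ∧
      rmap A (Submodule.inclusion hN₀) x₀ = x := by
  induction x using NTensor.induction_on with
  | zero => exact ⟨⊥, bot_le, 0, Submodule.fg_bot, map_zero _⟩
  | neg a m h =>
    obtain ⟨N₀, hN₀, x₀, hfg, hx₀⟩ := h
    exact ⟨N₀, hN₀, -x₀, hfg, by rw [map_neg, hx₀]⟩
  | tmul a m =>
    refine ⟨R ∙ (m : M), (Submodule.span_singleton_le_iff_mem _ _).2 m.2,
      tmul a ⟨m, Submodule.mem_span_singleton_self _⟩, Submodule.fg_span_singleton _, ?_⟩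
    rw [rmap_tmul]
    rfl
  | add x y hx hy =>
    obtain ⟨N₁, h₁, x₁, hfg₁, rfl⟩ := hx
    obtain ⟨N₂, h₂, x₂, hfg₂, rfl⟩ := hy
    refine ⟨N₁ ⊔ N₂, sup_le h₁ h₂, rmap A (Submodule.inclusion le_sup_left) x₁ +
      rmap A (Submodule.inclusion le_sup_right) x₂, hfg₁.sup hfg₂, ?_⟩
    rw [map_add, rmap_rmap, rmap_rmap]
    rfl

/-- A dual module `B⁺` with `Ext¹(M, B⁺) = 0` for all finitely presented `M` is injective. -/
theorem LeftDual.injective_of_extVanishes (B : Type u) [AddCommGroup B] [Module Rᵐᵒᵖ B]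
    (h : ∀ M : ModuleCat.{u} R, IsFinitelyPresented R M → ExtVanishes M (leftDualObj R B) 1) :
    Module.Injective R (LeftDual R B) := by
  refine Module.Baer.injective fun J φ => ?_
  have hinj : Function.Injective (NTensor.rmap B J.subtype) := by
    refine (injective_iff_map_eq_zero _).2 fun x hx => ?_
    obtain ⟨J₀, hJ₀, x₀, hfg, rfl⟩ := NTensor.exists_fg_rmap_eq x
    have hses : IsShortExact (K := ModuleCat.of R J₀) (G := ModuleCat.of R R)
        (M := ModuleCat.of R (R ⧸ J₀)) J₀.subtype J₀.mkQ :=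
      ⟨J₀.injective_subtype, J₀.mkQ_surjective, LinearMap.exact_subtype_mkQ J₀⟩
    have hfp : IsFinitelyPresented R (ModuleCat.of R (R ⧸ J₀)) :=
      Module.finitePresentation_of_free_of_surjective J₀.mkQ J₀.mkQ_surjective
        (by rwa [Submodule.ker_mkQ])
    have hJ₀inj := (NTensor.rmap_injective_iff (A := B) J₀.subtype).2
      (hses.exists_extension (h _ hfp))
    rw [NTensor.rmap_rmap, Submodule.subtype_comp_inclusion] at hx
    rw [(injective_iff_map_eq_zero _).1 hJ₀inj x₀ hx, map_zero]
  obtain ⟨ψ, hψ⟩ := (NTensor.rmap_injective_iff J.subtype).1 hinj φ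
  exact ⟨ψ, fun x hx => DFunLike.congr_fun hψ ⟨x, hx⟩⟩

end ExtVanishing

section GorensteinFlat

variable {R : Type u} [Ring R]

/-- `Extⁱ(M, I⁺) = 0`, i.e. `Torᵢ(I, M) = 0`, for every injective right module `I`. -/
def InjDualExtVanishes (M : ModuleCat.{u} R) (i : ℕ) : Prop :=
  ∀ (I : Type u) [AddCommGroup I] [Module Rᵐᵒᵖ I], Module.Injective Rᵐᵒᵖ I →
    ExtVanishes M (leftDualObj R I) i

/-- `X` is the kernel of an epimorphism from a flat module onto `Y`. -/
def IsFlatSyzygy (X Y : ModuleCat.{u} R) : Prop :=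
  ∃ (F : ModuleCat.{u} R) (f : X →ₗ[R] F) (g : F →ₗ[R] Y), IsFlatMod R F ∧ IsShortExact f g

/-- `M` embeds in a right resolution by flat modules all of whose cosyzygies, as well as `M`
itself, have vanishing `Extⁱ(-, I⁺)` for `i > 0` and `I` injective. -/
def HasFlatCoresolution (M : ModuleCat.{u} R) : Prop :=
  ∃ C : ℕ → ModuleCat.{u} R, C 0 = M ∧
    (∀ k i, InjDualExtVanishes (C k) (i + 1)) ∧ ∀ k, IsFlatSyzygy (C k) (C (k + 1))

theorem HasFlatCoresolution.injDualExtVanishes {M : ModuleCat.{u} R} (h : HasFlatCoresolution M)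
    (i : ℕ) : InjDualExtVanishes M (i + 1) := by
  obtain ⟨C, rfl, hC, -⟩ := h
  exact hC 0 i

theorem HasFlatCoresolution.exists_cosyzygy {M : ModuleCat.{u} R} (h : HasFlatCoresolution M) :
    ∃ N, IsFlatSyzygy M N ∧ HasFlatCoresolution N := by
  obtain ⟨C, rfl, hC, hs⟩ := h
  exact ⟨C 1, hs 0, fun k => C (k + 1), rfl, fun k => hC (k + 1), fun k => hs (k + 1)⟩

theorem HasFlatCoresolution.cons {M N : ModuleCat.{u} R} (h : HasFlatCoresolution N)
    (hM : ∀ i, InjDualExtVanishes M (i + 1)) (hMN : IsFlatSyzygy M N) :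
    HasFlatCoresolution M := by
  obtain ⟨C, rfl, hC, hs⟩ := h
  exact ⟨fun k => k.casesOn M C, rfl, fun k => k.casesOn hM hC, fun k => k.casesOn hMN hs⟩

/-- A syzygy of `M` with respect to the canonical free cover. -/
noncomputable def freeSyzygy (M : ModuleCat.{u} R) : ModuleCat.{u} R :=
  ModuleCat.of R (Finsupp.linearCombination R (id : M → M)).ker

theorem isFlatSyzygy_freeSyzygy (M : ModuleCat.{u} R) : IsFlatSyzygy (freeSyzygy M) M := by
  let p := Finsupp.linearCombination R (id : M → M)
  exact ⟨ModuleCat.of R (M →₀ R), p.ker.subtype, p,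
    @IsFlatMod.of_projective R _ (ModuleCat.of R (M →₀ R))
      (inferInstanceAs (Module.Projective R (M →₀ R))),
    ⟨p.ker.injective_subtype, Finsupp.linearCombination_id_surjective R M,
      p.exact_subtype_ker_map⟩⟩

theorem InjDualExtVanishes.of_isFlatSyzygy {M N : ModuleCat.{u} R} {i : ℕ}
    (h : InjDualExtVanishes N (i + 2)) (hMN : IsFlatSyzygy M N) :
    InjDualExtVanishes M (i + 1) := by
  intro I _ _ hI
  obtain ⟨F, f, g, hF, hfg⟩ := hMN
  exact hfg.extVanishes_left (hF.extVanishes_leftDual i I) (h I hI)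

/-- Splicing short exact sequences `0 → C n → F n → C (n + 1) → 0` with `F n` flat. -/
theorem IsGorensteinFlat.of_splice (C : ℤ → ModuleCat.{u} R)
    (hC : ∀ n, InjDualExtVanishes (C n) 1) (hs : ∀ n, IsFlatSyzygy (C n) (C (n + 1))) :
    IsGorensteinFlat R (C 1) := by
  choose F f g hF hfg using hs
  have hd : ∀ n, Function.Exact ((f (n + 1)).comp (g n)) ((f (n + 1 + 1)).comp (g (n + 1))) := by
    intro n x
    constructor
    · intro hx
      have hx' : g (n + 1) x = 0 :=
        (injective_iff_map_eq_zero _).1 (hfg (n + 1 + 1)).injective _ hx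
      obtain ⟨y, rfl⟩ := ((hfg (n + 1)).exact x).1 hx'
      obtain ⟨z, rfl⟩ := (hfg n).surjective y
      exact ⟨z, rfl⟩
    · rintro ⟨z, rfl⟩
      have : g (n + 1) (f (n + 1) (g n z)) = 0 := (hfg (n + 1)).exact.apply_apply_eq_zero _
      simp [this]
  refine ⟨F, fun n => (f (n + 1)).comp (g n), hF, hd, ⟨?_⟩, fun I _ _ hI n => ?_⟩
  · have hr : ((f (0 + 1)).comp (g 0)).range = (f 1).range :=
      LinearMap.range_comp_of_range_eq_top _ (LinearMap.range_eq_top.2 (hfg 0).surjective)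
    exact (LinearEquiv.ofInjective (f 1) (hfg 1).injective).trans (LinearEquiv.ofEq _ _ hr.symm)
  · refine (NTensor.rmap_exact_iff (hd n).linearMap_comp_eq_zero).2 fun φ hφ => ?_
    have hker : (g (n + 1)).ker ≤ φ.ker := by
      intro x hx
      obtain ⟨y, rfl⟩ := ((hfg (n + 1)).exact x).1 hx
      obtain ⟨z, rfl⟩ := (hfg n).surjective y
      exact DFunLike.congr_fun hφ z
    let e := (g (n + 1)).quotKerEquivOfSurjective (hfg (n + 1)).surjective
    obtain ⟨ψ, hψ⟩ := (hfg (n + 1 + 1)).exists_extension (hC _ I hI)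
      (((g (n + 1)).ker.liftQ φ hker).comp e.symm.toLinearMap)
    refine ⟨ψ, LinearMap.ext fun x => ?_⟩
    have h1 : e.symm (g (n + 1) x) = (g (n + 1)).ker.mkQ x := by
      rw [LinearEquiv.symm_apply_eq]
      rfl
    have h2 := DFunLike.congr_fun hψ (g (n + 1) x)
    simp only [LinearMap.comp_apply, LinearEquiv.coe_coe, h1] at h2
    exact h2

theorem HasFlatCoresolution.isGorensteinFlat {M : ModuleCat.{u} R} (h : HasFlatCoresolution M) :
    IsGorensteinFlat R M := by
  obtain ⟨C, rfl, hC, hs⟩ := h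
  let K : ℕ → ModuleCat.{u} R := fun k => freeSyzygy^[k] (C 0)
  have hK : ∀ k, IsFlatSyzygy (K (k + 1)) (K k) := fun k => by
    simp only [K, Function.iterate_succ_apply']
    exact isFlatSyzygy_freeSyzygy _
  have hKv : ∀ k i, InjDualExtVanishes (K k) (i + 1) := fun k => by
    induction k with
    | zero => exact hC 0
    | succ k ih => exact fun i => (ih (i + 1)).of_isFlatSyzygy (hK k)
  let D : ℤ → ModuleCat.{u} R := fun n =>
    match n with
    | .ofNat 0 => K 1
    | .ofNat (k + 1) => C k
    | .negSucc k => K (k + 2)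
  refine IsGorensteinFlat.of_splice D (fun n => ?_) (fun n => ?_)
  · match n with
    | .ofNat 0 => exact hKv 1 0
    | .ofNat (k + 1) => exact hC k 0
    | .negSucc k => exact hKv (k + 2) 0
  · match n with
    | .ofNat 0 => exact hK 0
    | .ofNat (k + 1) => exact hs k
    | .negSucc 0 => exact hK 1
    | .negSucc (k + 1) => exact hK (k + 2)

theorem IsGorensteinFlat.hasFlatCoresolution {M : ModuleCat.{u} R} (h : IsGorensteinFlat R M) :
    HasFlatCoresolution M := by
  obtain ⟨F, d, hF, hd, ⟨e⟩, hI⟩ := h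
  let Z : ℤ → ModuleCat.{u} R := fun n => ModuleCat.of R (d n).range
  have hsurj : ∀ n, Function.Surjective (d n).rangeRestrict := fun n => (d n).surjective_rangeRestrict
  have hses : ∀ n, IsShortExact (K := Z n) (M := Z (n + 1)) (d n).range.subtype
      (d (n + 1)).rangeRestrict := fun n =>
    ⟨Submodule.injective_subtype _, hsurj _, fun x => by
      rw [Subtype.ext_iff]
      refine (hd n x).trans ⟨?_, ?_⟩
      · rintro ⟨y, rfl⟩
        exact ⟨⟨d n y, y, rfl⟩, rfl⟩
      · rintro ⟨⟨_, y, rfl⟩, rfl⟩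
        exact ⟨y, rfl⟩⟩
  have hshift : ∀ {p : ℤ → Prop}, (∀ n, p (n + 1)) → ∀ n, p n := fun {p} hp n =>
    sub_add_cancel n 1 ▸ hp (n - 1)
  have hZ : ∀ i n, InjDualExtVanishes (Z n) (i + 1) := by
    intro i
    induction i with
    | zero =>
      refine hshift (hshift fun n I _ _ hI' => ?_)
      refine (hses (n + 1)).extVanishes_one ((hF _).extVanishes_leftDual 0 I) fun φ => ?_
      obtain ⟨ψ, hψ⟩ := (NTensor.rmap_exact_iff (hd n).linearMap_comp_eq_zero).1 (hI I hI' n)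
        (φ.comp (d (n + 1)).rangeRestrict) (by
          ext1 x
          have : (d (n + 1)).rangeRestrict (d n x) = 0 :=
            Subtype.ext ((hd n).apply_apply_eq_zero x)
          simp [this])
      refine ⟨ψ, LinearMap.ext fun x => ?_⟩
      obtain ⟨y, rfl⟩ := hsurj (n + 1) x
      exact DFunLike.congr_fun hψ y
    | succ i ih =>
      refine hshift fun n I _ _ hI' => ?_
      exact (hses n).extVanishes_right (ih n I hI') ((hF _).extVanishes_leftDual _ I)
  have hM : IsFlatSyzygy M (Z 1) := by
    refine ⟨F 1, (d 0).range.subtype.comp e.toLinearMap, (d 1).rangeRestrict, hF 1, ?_, hsurj 1,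
      fun x => ?_⟩
    · exact (Submodule.injective_subtype _).comp e.injective
    · refine ((hses 0).exact x).trans ⟨?_, ?_⟩
      · rintro ⟨y, rfl⟩
        exact ⟨e.symm y, congrArg Subtype.val (e.apply_symm_apply y)⟩
      · rintro ⟨y, rfl⟩
        exact ⟨e y, rfl⟩
  have hZ1 : HasFlatCoresolution (Z 1) :=
    ⟨fun k => Z (Int.ofNat (k + 1)), rfl, fun k i => hZ i _, fun k =>
      ⟨F (Int.ofNat (k + 1) + 1), _, _, hF _, hses (Int.ofNat (k + 1))⟩⟩
  exact hZ1.cons (fun i => (hZ (i + 1) 1).of_isFlatSyzygy hM) hM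

/-- The cokernel of a monomorphism of flat modules is flat as soon as its `Ext¹(-, I⁺)` vanishes
for injective `I`. -/
theorem IsFlatMod.cokernel {F G E : ModuleCat.{u} R} {f : F →ₗ[R] G} {g : G →ₗ[R] E}
    (hfg : IsShortExact f g) (hF : IsFlatMod R F) (hG : IsFlatMod R G)
    (hE : InjDualExtVanishes E 1) : IsFlatMod R E := by
  rw [isFlatMod_iff_injective_rightDual] at hF hG ⊢
  obtain ⟨ψ, hψ⟩ := hfg.exists_extension (hE (RightDual R F) hF)
    (dualFlip.symm (LinearMap.id : RightDual R F →ₗ[Rᵐᵒᵖ] RightDual R F))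
  have hs : ∀ (c : RightDual R F) (x : F), dualFlip ψ c (f x) = c x := fun c x =>
    DFunLike.congr_fun (DFunLike.congr_fun hψ x) c
  refine ⟨fun X Y _ _ _ _ i hi φ => ?_⟩
  obtain ⟨χ, hχ⟩ := hG.out i hi ((RightDual.map g).comp φ)
  have hker : ∀ y, ∃ c : RightDual R E,
      RightDual.map g c = χ y - dualFlip ψ (RightDual.map f (χ y)) := fun y =>
    ((AddMonoidHom.exact_iff_character f.toAddMonoidHom g.toAddMonoidHom).1 hfg.exact).2
      (χ y - dualFlip ψ (RightDual.map f (χ y))) (by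
        ext x
        change (χ y - dualFlip ψ (RightDual.map f (χ y))) (f x) = 0
        rw [RightDual.sub_apply, hs, RightDual.map_apply, sub_self])
  have hginj : Function.Injective (RightDual.map g) := fun c c' h => RightDual.ext fun m => by
    obtain ⟨z, rfl⟩ := hfg.surjective m
    exact DFunLike.congr_fun h z
  choose c hc using hker
  refine ⟨{ toFun := c, map_add' := fun y z => ?_, map_smul' := fun r y => ?_ }, fun x => ?_⟩
  · apply hginj
    simp only [map_add, hc]
    abel
  · apply hginj
    simp only [map_smul, hc, smul_sub, RingHom.id_apply]
  · apply hginj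
    have h0 : RightDual.map f (χ (i x)) = 0 := by
      rw [hχ]
      ext y
      have : g (f y) = 0 := hfg.exact.apply_apply_eq_zero y
      simp [this]
    change RightDual.map g (c (i x)) = _
    rw [hc, h0, map_zero, sub_zero, hχ]
    rfl

/-- A concrete pushout of `ι : K → G` along `j : K → F`. -/
theorem exists_pushout {K G F : ModuleCat.{u} R} (ι : K →ₗ[R] G) (j : K →ₗ[R] F) :
    ∃ (D : ModuleCat.{u} R) (a : G →ₗ[R] D) (b : F →ₗ[R] D),
      (∀ k, a (ι k) = b (j k)) ∧ (∀ x, ∃ y z, x = a y + b z) ∧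
      (∀ y z, a y + b z = 0 → ∃ k, ι k = y ∧ j k = -z) ∧
      ∀ (X : ModuleCat.{u} R) (p : G →ₗ[R] X) (q : F →ₗ[R] X), (∀ k, p (ι k) = q (j k)) →
        ∃ r : D →ₗ[R] X, (∀ y, r (a y) = p y) ∧ ∀ z, r (b z) = q z := by
  let N : Submodule R (G × F) := (ι.prod (-j)).range
  have hN : ∀ y z, N.mkQ (y, z) = N.mkQ (y, 0) + N.mkQ (0, z) := fun y z => by
    rw [← map_add, Prod.mk_add_mk, add_zero, zero_add]
  refine ⟨ModuleCat.of R ((G × F) ⧸ N), N.mkQ.comp (LinearMap.inl R G F),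
    N.mkQ.comp (LinearMap.inr R G F), fun k => ?_, fun x => ?_, fun y z h => ?_,
    fun X p q hpq => ?_⟩
  · refine (Submodule.Quotient.eq N).2 ⟨k, ?_⟩
    simp
  · obtain ⟨⟨y, z⟩, rfl⟩ := N.mkQ_surjective x
    exact ⟨y, z, hN y z⟩
  · have : N.mkQ (y, z) = 0 := (hN y z).trans h
    obtain ⟨k, hk⟩ := (Submodule.Quotient.mk_eq_zero N).1 this
    have hz : -j k = z := congrArg Prod.snd hk
    exact ⟨k, congrArg Prod.fst hk, by rw [← hz, neg_neg]⟩
  · refine ⟨N.liftQ (p.coprod q) ?_, fun y => ?_, fun z => ?_⟩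
    · rintro _ ⟨k, rfl⟩
      simp [hpq]
    · exact (N.liftQ_apply _ _).trans (by simp)
    · exact (N.liftQ_apply _ _).trans (by simp)

theorem IsShortExact.exists_pushout {K G M F : ModuleCat.{u} R} {ι : K →ₗ[R] G} {π : G →ₗ[R] M}
    (h : IsShortExact ι π) (j : K →ₗ[R] F) :
    ∃ (D : ModuleCat.{u} R) (a : G →ₗ[R] D) (b : F →ₗ[R] D) (r : D →ₗ[R] M),
      IsShortExact b r ∧ (∀ k, a (ι k) = b (j k)) ∧ (∀ x, ∃ y z, x = a y + b z) ∧
      (∀ y z, a y + b z = 0 → ∃ k, ι k = y ∧ j k = -z) ∧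
      ∀ (X : ModuleCat.{u} R) (p : G →ₗ[R] X) (q : F →ₗ[R] X), (∀ k, p (ι k) = q (j k)) →
        ∃ r : D →ₗ[R] X, (∀ y, r (a y) = p y) ∧ ∀ z, r (b z) = q z := by
  obtain ⟨D, a, b, hab, hD, h0, hu⟩ := _root_.exists_pushout ι j
  obtain ⟨r, hra, hrb⟩ := hu M π 0 (fun k => h.exact.apply_apply_eq_zero k)
  refine ⟨D, a, b, r, ⟨?_, fun m => ?_, fun x => ⟨fun hx => ?_, ?_⟩⟩, hab, hD, h0, hu⟩
  · refine (injective_iff_map_eq_zero _).2 fun z hz => ?_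
    obtain ⟨k, hk, hk'⟩ := h0 0 z (by simpa using hz)
    rw [(injective_iff_map_eq_zero _).1 h.injective k hk, map_zero] at hk'
    exact neg_eq_zero.1 hk'.symm
  · obtain ⟨y, rfl⟩ := h.surjective m
    exact ⟨a y, hra y⟩
  · obtain ⟨y, z, rfl⟩ := hD x
    rw [map_add, hra, hrb, LinearMap.zero_apply, add_zero] at hx
    obtain ⟨k, rfl⟩ := (h.exact y).1 hx
    exact ⟨j k + z, by rw [map_add, hab]⟩
  · rintro ⟨z, rfl⟩
    exact hrb z

theorem IsGorensteinFlat.of_isShortExact (hR : IsGFClosed R) {K G M : ModuleCat.{u} R}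
    {ι : K →ₗ[R] G} {π : G →ₗ[R] M} (h : IsShortExact ι π) (hK : IsGorensteinFlat R K)
    (hG : IsGorensteinFlat R G) (hM : ∀ i, InjDualExtVanishes M (i + 1)) :
    IsGorensteinFlat R M := by
  obtain ⟨H, ⟨F, j, q, hF, hjq⟩, hH⟩ := hK.hasFlatCoresolution.exists_cosyzygy
  obtain ⟨D, a, b, r, hbr, hab, hDs, hD0, hDu⟩ := h.exists_pushout j
  have hDG : IsGorensteinFlat R D := by
    obtain ⟨s, hsa, hsb⟩ := hDu H 0 q (fun k => (hjq.exact.apply_apply_eq_zero k).symm)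
    refine hR G D H a s ?_ (fun y => ?_) (fun x => ⟨fun hx => ?_, ?_⟩) hG hH.isGorensteinFlat
    · refine (injective_iff_map_eq_zero _).2 fun y hy => ?_
      obtain ⟨k, rfl, hk⟩ := hD0 y 0 (by simpa using hy)
      rw [(injective_iff_map_eq_zero _).1 hjq.injective k (by simpa using hk), map_zero]
    · obtain ⟨z, rfl⟩ := hjq.surjective y
      exact ⟨b z, hsb z⟩
    · obtain ⟨y, z, rfl⟩ := hDs x
      rw [map_add, hsa, hsb, LinearMap.zero_apply, zero_add] at hx
      obtain ⟨k, rfl⟩ := (hjq.exact z).1 hx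
      exact ⟨y + ι k, by rw [map_add, hab]⟩
    · rintro ⟨y, rfl⟩
      exact hsa y
  obtain ⟨G', ⟨F', k, p, hF', hkp⟩, hG'⟩ := hDG.hasFlatCoresolution.exists_cosyzygy
  obtain ⟨E, c, m, t, hmt, hcm, hEs, hE0, -⟩ := hkp.exists_pushout r
  have hFE : IsShortExact (k.comp b) c := by
    refine ⟨hkp.injective.comp hbr.injective, fun x => ?_, fun y => ⟨fun hy => ?_, ?_⟩⟩
    · obtain ⟨y, z, rfl⟩ := hEs x
      obtain ⟨w, rfl⟩ := hbr.surjective z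
      exact ⟨y + k w, by rw [map_add, hcm]⟩
    · obtain ⟨w, rfl, hw⟩ := hE0 y 0 (by simpa using hy)
      obtain ⟨z, rfl⟩ := (hbr.exact w).1 (by simpa using hw)
      exact ⟨z, rfl⟩
    · rintro ⟨z, rfl⟩
      have : r (b z) = 0 := hbr.exact.apply_apply_eq_zero z
      rw [LinearMap.comp_apply, hcm, this, map_zero]
  have hE : IsFlatMod R E := hF.cokernel hFE hF' fun I _ _ hI =>
    hmt.extVanishes_mid (hM 0 I hI) (hG'.injDualExtVanishes 0 I hI)
  exact (hG'.cons hM ⟨E, m, t, hE, hmt⟩).isGorensteinFlat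

theorem InjDualExtVanishes.of_gflatDimLE {n : ℕ} : ∀ {M : ModuleCat.{u} R}, gflatDimLE R n M →
    ∀ i, n < i → InjDualExtVanishes M i := by
  induction n with
  | zero =>
    intro M hM i hi
    obtain ⟨i, rfl⟩ := Nat.exists_eq_succ_of_ne_zero hi.ne'
    exact hM.hasFlatCoresolution.injDualExtVanishes i
  | succ n ih =>
    rintro M ⟨K, G, ι, π, hι, hπ, hex, hG, hK⟩ i hi I _ _ hI
    obtain ⟨i, rfl⟩ := Nat.exists_eq_succ_of_ne_zero (Nat.ne_zero_of_lt hi)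
    exact IsShortExact.extVanishes_right ⟨hι, hπ, hex⟩ (ih hK i (by omega) I hI)
      (hG.hasFlatCoresolution.injDualExtVanishes i I hI)

theorem gflatDimLE_of_succ (hR : IsGFClosed R) {n : ℕ} : ∀ {M : ModuleCat.{u} R},
    gflatDimLE R (n + 1) M → (∀ i, n < i → InjDualExtVanishes M i) → gflatDimLE R n M := by
  induction n with
  | zero =>
    rintro M ⟨K, G, ι, π, hι, hπ, hex, hG, hK⟩ hM
    exact IsGorensteinFlat.of_isShortExact hR ⟨hι, hπ, hex⟩ hK hG fun i => hM _ i.succ_pos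
  | succ n ih =>
    rintro M ⟨K, G, ι, π, hι, hπ, hex, hG, hK⟩ hM
    refine ⟨K, G, ι, π, hι, hπ, hex, hG, ih hK fun i hi I _ _ hI => ?_⟩
    obtain ⟨i, rfl⟩ := Nat.exists_eq_succ_of_ne_zero (Nat.ne_zero_of_lt hi)
    exact IsShortExact.extVanishes_left ⟨hι, hπ, hex⟩
      (hG.hasFlatCoresolution.injDualExtVanishes i I hI) (hM _ (by omega) I hI)

theorem gflatDimLE.exists_le (hR : IsGFClosed R) {n m : ℕ} {M : ModuleCat.{u} R}
    (hM : ∀ i, n < i → InjDualExtVanishes M i) (hm : gflatDimLE R m M) :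
    ∃ k ≤ n, gflatDimLE R k M := by
  induction m with
  | zero => exact ⟨0, n.zero_le, hm⟩
  | succ m ih =>
    by_cases hle : m + 1 ≤ n
    · exact ⟨m + 1, hle, hm⟩
    · exact ih (gflatDimLE_of_succ hR hm fun i hi => hM i (by omega))

theorem gflatDim_le_iff {n : ℕ} {M : ModuleCat.{u} R} :
    gflatDim R M ≤ n ↔ ∃ k ≤ n, gflatDimLE R k M := by
  constructor
  · intro h
    have hne : {d : ℕ∞ | ∃ k : ℕ, d = k ∧ gflatDimLE R k M}.Nonempty := by
      by_contra hempty
      rw [gflatDim, Set.not_nonempty_iff_eq_empty.1 hempty, sInf_empty, top_le_iff] at h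
      exact ENat.natCast_ne_top n h
    obtain ⟨k, hk, hkM⟩ := csInf_mem hne
    refine ⟨k, ?_, hkM⟩
    rw [gflatDim, hk] at h
    exact_mod_cast h
  · rintro ⟨k, hk, hkM⟩
    have hle : gflatDim R M ≤ (k : ℕ∞) := sInf_le ⟨k, rfl, hkM⟩
    exact hle.trans (by exact_mod_cast hk)

/-- If `Extⁿ⁺¹(M, I⁺)` vanishes for all finitely presented `M` and all injective `I`, then all
higher `Ext` into the modules `I⁺` vanish. -/
theorem injDualExtVanishes_of_finitelyPresented {n : ℕ}
    (h : ∀ M : ModuleCat.{u} R, IsFinitelyPresented R M → InjDualExtVanishes M (n + 1))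
    (M : ModuleCat.{u} R) (i : ℕ) (hi : n < i) : InjDualExtVanishes M i := by
  intro I _ _ hI
  obtain ⟨B, _, _, hB⟩ := exists_extVanishes_leftDual_iff (R := R) n I
  obtain ⟨k, rfl⟩ := Nat.exists_eq_add_of_lt hi
  refine (hB M k).2 (extVanishes_of_injective _ _ ?_ k)
  exact LeftDual.injective_of_extVanishes B fun N hN => (hB N 0).1 (h N hN I hI)

end GorensteinFlat

/-- **Lemma 2.4 (1 ⇔ 2).**  If `R` is a left GF-closed ring with `l.Gwdim(R) < ∞` and `n` is a
positive integer, then `l.Gwdim(R) ≤ n` iff `Gfd_R(M) ≤ n` for every finitely presented left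
`R`-module `M`. -/
theorem gorensteinWeakGlobalDim_le_iff_gflatDim_finitelyPresented_le (R : Type u) [Ring R]
    (h : IsGFClosed R) (hfin : gorensteinWeakGlobalDim R ≠ ⊤) (n : ℕ) (hn : 0 < n) :
    gorensteinWeakGlobalDim R ≤ (n : ℕ∞) ↔
      ∀ M : ModuleCat.{u} R, IsFinitelyPresented R M → gflatDim R M ≤ (n : ℕ∞) := by
  refine ⟨fun hle M _ => (le_iSup (gflatDim R) M).trans hle, fun hfp => iSup_le fun M => ?_⟩
  obtain ⟨N, hN⟩ := ENat.ne_top_iff_exists.1 hfin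
  obtain ⟨m, -, hm⟩ := gflatDim_le_iff.1 ((le_iSup (gflatDim R) M).trans hN.ge)
  refine gflatDim_le_iff.2 (hm.exists_le h (injDualExtVanishes_of_finitelyPresented ?_ M))
  intro P hP
  obtain ⟨k, hk, hkP⟩ := gflatDim_le_iff.1 (hfp P hP)
  exact InjDualExtVanishes.of_gflatDimLE hkP _ (by omega)
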